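/- Let f* : D → C be a coproduct-preserving tensor-exact functor between rigidly-compactly generated tensor-triangulated categories, with adjoints f* ⊣ f_* ⊣ f^(1). Let C₀ be a C^c-submodule of C admitting a (possibly external) dualizing object κ' ∈ C, and assume κ' admits a Matlis lift, i.e. there exists κ ∈ D with f^(1)(κ) ≅ κ'. Then κ is a (possibly external) dualizing object for the thick subcategory D₀ := thick(f_*(C₀)) of D generated by the image of C₀ under f_*; that is, D_κ := hom_D(−,κ) restricts to an anti-equivalence D₀^op ≃ D₀. -/

import Mathlib

/-!
Formalization of statements from "Grothendieck-Neeman duality and the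
Wirthmüller isomorphism" by Balmer, Dell'Ambrogio and Sanders.
-/

noncomputable section

open CategoryTheory CategoryTheory.Limits CategoryTheory.Pretriangulated
  CategoryTheory.MonoidalCategory CategoryTheory.MonoidalClosed Opposite

universe v u u₁ u₂ u₃

namespace GN

section Compact

variable {C : Type u} [Category.{v} C]

/-- An object `t` is compact if `Hom(t, -)`, viewed as a functor to abelian groups,
preserves small coproducts. -/
def IsCompactObj [Preadditive C] (t : C) : Prop :=
  ∀ J : Type v, Nonempty (PreservesColimitsOfShape (Discrete J)
    (preadditiveCoyoneda.obj (op t)))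

/-- A functor preserves arbitrary (small) coproducts. -/
def PreservesCoproducts {D : Type u₂} [Category.{v} D] (F : C ⥤ D) : Prop :=
  ∀ J : Type v, Nonempty (PreservesColimitsOfShape (Discrete J) F)

/-- A functor preserves arbitrary (small) products. -/
def PreservesProducts {D : Type u₂} [Category.{v} D] (F : C ⥤ D) : Prop :=
  ∀ J : Type v, Nonempty (PreservesLimitsOfShape (Discrete J) F)

/-- A compactly generated category: it admits all small coproducts and
has a set of compact generators. -/
structure CompactlyGenerated (C : Type u) [Category.{v} C] [Preadditive C] : Prop where
  hasCoproducts : HasCoproducts.{v} C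
  exists_generators : ∃ (ι : Type v) (G : ι → C), (∀ i, IsCompactObj (G i)) ∧
    ∀ t : C, (∀ (i : ι) (f : G i ⟶ t), f = 0) → IsZero t

end Compact

section Tensor

variable {C : Type u} [Category.{v} C] [MonoidalCategory C] [MonoidalClosed C]

/-- The canonical map `hom(x,𝟙) ⊗ y ⟶ hom(x,y)`. -/
def rigidComparison (x y : C) : (ihom x).obj (𝟙_ C) ⊗ y ⟶ (ihom x).obj y :=
  MonoidalClosed.curry ((α_ x ((ihom x).obj (𝟙_ C)) y).inv ≫
    (((ihom.ev x).app (𝟙_ C)) ▷ y) ≫ (λ_ y).hom)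

/-- An object `x` is rigid if `hom(x,𝟙) ⊗ y ⟶ hom(x,y)` is an isomorphism for all `y`. -/
def IsRigid (x : C) : Prop := ∀ y : C, IsIso (rigidComparison x y)

/-- An object `u` is `⊗`-invertible if `u ⊗ v ≅ 𝟙` for some `v`. -/
def TensorInvertible (u : C) : Prop := ∃ v : C, Nonempty (u ⊗ v ≅ 𝟙_ C)

/-- The `κ`-twisted duality functor `D_κ = hom(-,κ)`. -/
@[reducible] def Dfun (κ : C) : Cᵒᵖ ⥤ C := MonoidalClosed.internalHom.flip.obj κ

/-- The canonical double-duality map `ϖ : x ⟶ D_κ D_κ (x)`, i.e. the unit/counit of the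
self-adjunction of `D_κ = hom(-,κ)`. -/
def varpi [BraidedCategory C] (κ x : C) : x ⟶ (ihom ((ihom x).obj κ)).obj κ :=
  MonoidalClosed.curry ((β_ ((ihom x).obj κ) x).hom ≫ (ihom.ev x).app κ)

/-- A rigidly-compactly generated tensor-triangulated category: it admits all small
coproducts, its compact objects coincide with its rigid objects, and it has a set of
compact generators. -/
structure RigidlyCompactlyGenerated (C : Type u) [Category.{v} C] [Preadditive C]
    [MonoidalCategory C] [MonoidalClosed C] : Prop where
  hasCoproducts : HasCoproducts.{v} C
  compact_iff_rigid : ∀ x : C, IsCompactObj x ↔ IsRigid x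
  exists_generators : ∃ (ι : Type v) (G : ι → C), (∀ i, IsCompactObj (G i)) ∧
    ∀ t : C, (∀ (i : ι) (f : G i ⟶ t), f = 0) → IsZero t

end Tensor

section Triang

variable {C : Type u} [Category.{v} C] [HasZeroObject C] [Preadditive C] [HasShift C ℤ]
  [∀ n : ℤ, (shiftFunctor C n).Additive] [Pretriangulated C]

/-- A thick triangulated subcategory, given as a predicate on objects:
it contains the zero objects, and is closed under shifts, cones and direct summands
(hence in particular under isomorphisms). -/
structure IsThickSubcategory (S : Set C) : Prop where
  zero : ∀ x : C, IsZero x → x ∈ S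
  shift : ∀ x ∈ S, ∀ n : ℤ, x⟦n⟧ ∈ S
  ext₃ : ∀ T : Triangle C, (T ∈ distTriang C) → T.obj₁ ∈ S → T.obj₂ ∈ S → T.obj₃ ∈ S
  retract : ∀ x y : C, (∃ (s : x ⟶ y) (r : y ⟶ x), s ≫ r = 𝟙 x) → y ∈ S → x ∈ S

/-- The thick subcategory generated by a set of objects. -/
def thickClosure (S : Set C) : Set C :=
  { x | ∀ T : Set C, IsThickSubcategory T → S ⊆ T → x ∈ T }

/-- A `C^c`-submodule of `C`: a thick triangulated subcategory which is closed under
tensoring with compact objects. -/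
structure IsSubmodule [MonoidalCategory C] (S : Set C) extends IsThickSubcategory S : Prop where
  smul : ∀ c x : C, IsCompactObj c → x ∈ S → (c ⊗ x) ∈ S

end Triang

section Dual

variable {C : Type u} [Category.{v} C] [MonoidalCategory C] [BraidedCategory C]
  [MonoidalClosed C]

/-- `κ` is a (possibly external) dualizing object for `S ⊆ C`: the `κ`-twisted
duality `D_κ = hom(-,κ)` preserves `S` and every object of `S` is `κ`-reflexive;
equivalently, `D_κ` restricts to an anti-equivalence `S^op ≃ S`. -/
structure IsExternalDualizing (S : Set C) (κ : C) : Prop where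
  stable : ∀ x ∈ S, (ihom x).obj κ ∈ S
  reflexive : ∀ x ∈ S, IsIso (varpi κ x)

/-- `κ ∈ S` is a dualizing object for `S`. -/
structure IsDualizing (S : Set C) (κ : C) extends IsExternalDualizing S κ : Prop where
  mem : κ ∈ S

end Dual

section Pullback

variable {C : Type u₁} {D : Type u₂} [Category.{v} C] [Category.{v} D]
  [Preadditive C] [MonoidalCategory C]

/-- The compact pull-back `f^#(D₀)` of a subcategory `D₀ ⊆ D` along `f_* : C ⥤ D`. -/
def compactPullback (fpush : C ⥤ D) (D₀ : Set D) : Set C :=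
  { x | ∀ c : C, IsCompactObj c → fpush.obj (c ⊗ x) ∈ D₀ }

end Pullback

section Proj

variable {D : Type u₁} {C : Type u₂} [Category.{v} D] [Category.{v} C]
  [MonoidalCategory D] [MonoidalCategory C]

/-- The canonical projection formula map `π : x ⊗ f_*(y) ⟶ f_*(f^*(x) ⊗ y)`,
obtained by adjunction from `f^*(x ⊗ f_* y) ≅ f^* x ⊗ f^* f_* y → f^* x ⊗ y`. -/
def projFormula (fstar : D ⥤ C) [fstar.Monoidal] (fpush : C ⥤ D) (adj : fstar ⊣ fpush)
    (x : D) (y : C) : x ⊗ fpush.obj y ⟶ fpush.obj (fstar.obj x ⊗ y) :=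
  (adj.homEquiv _ _)
    (Functor.OplaxMonoidal.δ fstar x (fpush.obj y) ≫ (fstar.obj x ◁ adj.counit.app y))

/-- The canonical comparison map `f^(1)(x) ⊗ f^*(y) ⟶ f^(1)(x ⊗ y)`, obtained by
adjunction from the counit `f_* f^(1) → Id` via the projection formula. -/
def gnComparison [BraidedCategory D] [BraidedCategory C] (fstar : D ⥤ C) [fstar.Monoidal]
    (fpush : C ⥤ D) (adj1 : fstar ⊣ fpush) (fone : D ⥤ C) (adj2 : fpush ⊣ fone)
    (hπ : ∀ (x : D) (y : C), IsIso (projFormula fstar fpush adj1 x y)) (x y : D) :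
    fone.obj x ⊗ fstar.obj y ⟶ fone.obj (x ⊗ y) :=
  haveI := hπ y (fone.obj x)
  (adj2.homEquiv _ _)
    (fpush.map (β_ (fone.obj x) (fstar.obj y)).hom ≫
      inv (projFormula fstar fpush adj1 y (fone.obj x)) ≫
      (β_ y (fpush.obj (fone.obj x))).hom ≫ (adj2.counit.app x ▷ y))

end Proj

section Exactness

variable {C : Type u} [Category.{v} C] [Preadditive C]

/-- The sequence `X ⟶ Y ⟶ Z` becomes exact at `Y` after applying `Hom(T, -)` for every `T`. -/
structure CovExact {X Y Z : C} (p : X ⟶ Y) (q : Y ⟶ Z) : Prop where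
  zero : p ≫ q = 0
  lift : ∀ {T : C} (g : T ⟶ Y), g ≫ q = 0 → ∃ l : T ⟶ X, l ≫ p = g

/-- The sequence `X ⟶ Y ⟶ Z` becomes exact at `Y` after applying `Hom(-, T)` for every `T`. -/
structure ContraExact {X Y Z : C} (p : X ⟶ Y) (q : Y ⟶ Z) : Prop where
  zero : p ≫ q = 0
  desc : ∀ {T : C} (g : Y ⟶ T), p ≫ g = 0 → ∃ l : Z ⟶ T, q ≫ l = g

/-- The five lemma for covariantly exact sequences. -/
lemma isIso_of_covExact {A₁ A₂ A₃ A₄ A₅ B₁ B₂ B₃ B₄ B₅ : C}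
    {f₁ : A₁ ⟶ A₂} {f₂ : A₂ ⟶ A₃} {f₃ : A₃ ⟶ A₄} {f₄ : A₄ ⟶ A₅}
    {g₁ : B₁ ⟶ B₂} {g₂ : B₂ ⟶ B₃} {g₃ : B₃ ⟶ B₄} {g₄ : B₄ ⟶ B₅}
    (hf₁ : CovExact f₁ f₂) (hf₂ : CovExact f₂ f₃) (hf₃ : CovExact f₃ f₄)
    (hg₁ : CovExact g₁ g₂) (hg₂ : CovExact g₂ g₃) (hg₃ : CovExact g₃ g₄)
    (v₁ : A₁ ⟶ B₁) (v₂ : A₂ ⟶ B₂) (v₃ : A₃ ⟶ B₃) (v₄ : A₄ ⟶ B₄) (v₅ : A₅ ⟶ B₅)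
    (w₁ : f₁ ≫ v₂ = v₁ ≫ g₁) (w₂ : f₂ ≫ v₃ = v₂ ≫ g₂)
    (w₃ : f₃ ≫ v₄ = v₃ ≫ g₃) (w₄ : f₄ ≫ v₅ = v₄ ≫ g₄)
    [IsIso v₁] [IsIso v₂] [IsIso v₄] [IsIso v₅] : IsIso v₃ := by
  have hmono : Mono v₃ := Preadditive.mono_of_cancel_zero _ fun {T} t ht => by
    obtain ⟨s, rfl⟩ := hf₂.lift t (by
      rw [← cancel_mono v₄, Category.assoc, w₃, reassoc_of% ht, zero_comp, zero_comp])
    obtain ⟨r, hr⟩ := hg₁.lift (s ≫ v₂) (by rw [Category.assoc, ← w₂, ← Category.assoc, ht])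
    have hs : s = (r ≫ inv v₁) ≫ f₁ := by
      rw [← cancel_mono v₂, Category.assoc, w₁, ← hr]; simp
    rw [hs, Category.assoc, hf₁.zero, comp_zero]
  obtain ⟨s, hs⟩ := hf₃.lift (g₃ ≫ inv v₄) (by
    rw [← cancel_mono v₅, Category.assoc, Category.assoc, w₄, IsIso.inv_hom_id_assoc, hg₃.zero,
      zero_comp])
  obtain ⟨r, hr⟩ := hg₂.lift (𝟙 B₃ - s ≫ v₃) (by
    rw [Preadditive.sub_comp, Category.assoc, ← w₃, reassoc_of% hs]; simp)
  have hsplit : (s + r ≫ inv v₂ ≫ f₂) ≫ v₃ = 𝟙 _ := by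
    simp only [Preadditive.add_comp, Category.assoc, w₂, IsIso.inv_hom_id_assoc, hr]
    abel
  exact ⟨_, by rw [← cancel_mono v₃, Category.assoc, hsplit]; simp, hsplit⟩

variable [HasShift C ℤ] [∀ n : ℤ, (shiftFunctor C n).Additive]

lemma IsCompactObj.shift {t : C} (ht : IsCompactObj t) (n : ℤ) : IsCompactObj (t⟦n⟧) := by
  intro J
  obtain ⟨_⟩ := ht J
  let adj := (shiftEquiv C n).toAdjunction
  have : (shiftEquiv C n).functor.Additive := inferInstanceAs (shiftFunctor C n).Additive
  let e : (shiftEquiv C n).inverse ⋙ preadditiveCoyoneda.obj (op t) ≅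
      preadditiveCoyoneda.obj (op (t⟦n⟧)) :=
    NatIso.ofComponents (fun X => (adj.homAddEquiv t X).symm.toAddCommGrpIso) (fun {X Y} f => by
      ext g
      exact adj.homEquiv_naturality_right_symm g f)
  exact ⟨preservesColimitsOfShape_of_natIso e⟩

variable [HasZeroObject C] [Pretriangulated C]

lemma covExact_of_distTriang (T : Triangle C) (hT : T ∈ distTriang C) :
    CovExact T.mor₁ T.mor₂ where
  zero := comp_distTriang_mor_zero₁₂ T hT
  lift g hg := by
    obtain ⟨l, hl⟩ := T.coyoneda_exact₂ hT g hg
    exact ⟨l, hl.symm⟩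

lemma contraExact_of_distTriang (T : Triangle C) (hT : T ∈ distTriang C) :
    ContraExact T.mor₁ T.mor₂ where
  zero := comp_distTriang_mor_zero₁₂ T hT
  desc g hg := by
    obtain ⟨l, hl⟩ := T.yoneda_exact₂ hT g hg
    exact ⟨l, hl.symm⟩

/-- Every morphism has a covariant weak kernel which is also a contravariant weak cokernel. -/
lemma exists_fiber {Z W : C} (r : Z ⟶ W) :
    ∃ (V F : C) (z : V ⟶ F) (i : F ⟶ Z), CovExact i r ∧ ContraExact z i := by
  obtain ⟨F, i, j, hF⟩ := distinguished_cocone_triangle₁ r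
  exact ⟨_, F, _, i, covExact_of_distTriang _ hF,
    contraExact_of_distTriang _ (inv_rot_of_distTriang _ hF)⟩

/-- In a pretriangulated category, representable functors are injective relative to covariantly
exact sequences. -/
lemma CovExact.contraExact {X Y Z W : C} {p : X ⟶ Y} {q : Y ⟶ Z} {r : Z ⟶ W}
    (hpq : CovExact p q) (hqr : CovExact q r) : ContraExact p q where
  zero := hpq.zero
  desc {T} g hg := by
    obtain ⟨V, F, z, i, hir, hzi⟩ := exists_fiber r
    obtain ⟨b, hb⟩ := hqr.lift i hir.zero
    obtain ⟨a, ha⟩ := hir.lift q hqr.zero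
    obtain ⟨s, hs⟩ := hzi.desc (b ≫ g) (by
      obtain ⟨l, hl⟩ := hpq.lift (z ≫ b) (by rw [Category.assoc, hb, hzi.zero])
      rw [← reassoc_of% hl, hg, comp_zero])
    obtain ⟨l, hl⟩ := hpq.lift (𝟙 Y - a ≫ b) (by simp [Preadditive.sub_comp, hb, ha])
    refine ⟨s, ?_⟩
    have h : (𝟙 Y - a ≫ b) ≫ g = 0 := by rw [← hl, Category.assoc, hg, comp_zero]
    rw [Preadditive.sub_comp, Category.id_comp, sub_eq_zero, Category.assoc] at h
    rw [h, ← ha, Category.assoc, hs]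

lemma IsThickSubcategory.mem_of_iso {S : Set C} (hS : IsThickSubcategory S) {x y : C}
    (e : x ≅ y) (hx : x ∈ S) : y ∈ S :=
  hS.retract y x ⟨e.inv, e.hom, e.inv_hom_id⟩ hx

lemma IsThickSubcategory.ext₂ {S : Set C} (hS : IsThickSubcategory S) (T : Triangle C)
    (hT : T ∈ distTriang C) (h₁ : T.obj₁ ∈ S) (h₃ : T.obj₃ ∈ S) : T.obj₂ ∈ S :=
  hS.ext₃ _ (inv_rot_of_distTriang _ hT) (hS.shift _ h₃ (-1)) h₁

lemma IsThickSubcategory.ext₁ {S : Set C} (hS : IsThickSubcategory S) (T : Triangle C)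
    (hT : T ∈ distTriang C) (h₂ : T.obj₂ ∈ S) (h₃ : T.obj₃ ∈ S) : T.obj₁ ∈ S :=
  hS.ext₂ _ (inv_rot_of_distTriang _ hT) (hS.shift _ h₃ (-1)) h₂

lemma IsThickSubcategory.biprod {S : Set C} (hS : IsThickSubcategory S) {x y : C}
    (hx : x ∈ S) (hy : y ∈ S) : (x ⊞ y) ∈ S :=
  hS.ext₂ _ (binaryBiproductTriangle_distinguished x y) hx hy

/-- If `X ⟶ Y ⟶ Z ⟶ W` is covariantly exact, then `Y` lies in every thick subcategory
containing `X`, `Z` and `W`. -/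
lemma IsThickSubcategory.mem_of_covExact {S : Set C} (hS : IsThickSubcategory S)
    {X Y Z W : C} {p : X ⟶ Y} {q : Y ⟶ Z} {r : Z ⟶ W}
    (hpq : CovExact p q) (hqr : CovExact q r) (hX : X ∈ S) (hZ : Z ∈ S) (hW : W ∈ S) :
    Y ∈ S := by
  obtain ⟨F, i, j, hF⟩ := distinguished_cocone_triangle₁ r
  have hir := covExact_of_distTriang _ hF
  obtain ⟨b, hb⟩ : ∃ b : F ⟶ Y, b ≫ q = i := hqr.lift i hir.zero
  obtain ⟨a, ha⟩ : ∃ a : Y ⟶ F, a ≫ i = q := hir.lift q hqr.zero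
  obtain ⟨l, hl⟩ := hpq.lift (𝟙 Y - a ≫ b) (by simp [Preadditive.sub_comp, hb, ha])
  refine hS.retract Y (F ⊞ X) ⟨biprod.lift a l, biprod.desc b p, ?_⟩
    (hS.biprod (hS.ext₁ _ hF hZ hW) hX)
  rw [biprod.lift_desc, hl]
  abel

lemma isThickSubcategory_thickClosure (S : Set C) : IsThickSubcategory (thickClosure S) where
  zero x hx _ hT _ := hT.zero x hx
  shift x hx n T hT hS := hT.shift x (hx T hT hS) n
  ext₃ t ht h₁ h₂ T hT hS := hT.ext₃ t ht (h₁ T hT hS) (h₂ T hT hS)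
  retract x y h hy T hT hS := hT.retract x y h (hy T hT hS)

lemma subset_thickClosure (S : Set C) : S ⊆ thickClosure S :=
  fun _ hx _ _ hS => hS hx

/-- Compact objects detect isomorphisms as soon as they generate. -/
lemma isIso_of_bijective_of_isCompactObj {ι : Type v} {G : ι → C}
    (hG : ∀ i, IsCompactObj (G i))
    (hG₀ : ∀ t : C, (∀ (i : ι) (f : G i ⟶ t), f = 0) → IsZero t) {X Y : C} (φ : X ⟶ Y)
    (hφ : ∀ t : C, IsCompactObj t → Function.Bijective (fun g : t ⟶ X => g ≫ φ)) :
    IsIso φ := by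
  obtain ⟨Z, g, h, hT⟩ := distinguished_cocone_triangle φ
  have hφg : φ ≫ g = 0 := comp_distTriang_mor_zero₁₂ _ hT
  have hhφ : h ≫ φ⟦(1 : ℤ)⟧' = 0 := comp_distTriang_mor_zero₃₁ _ hT
  refine (Triangle.isZero₃_iff_isIso₁ _ hT).1 (hG₀ Z fun i k => ?_)
  let e := shiftFunctorCompIsoId C (1 : ℤ) (-1) (by simp)
  have he : (h⟦(-1 : ℤ)⟧' ≫ e.hom.app X) ≫ φ = 0 := by
    have hnat : (φ⟦(1 : ℤ)⟧')⟦(-1 : ℤ)⟧' ≫ e.hom.app Y = e.hom.app X ≫ φ := e.hom.naturality φ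
    rw [Category.assoc, ← hnat, ← Functor.map_comp_assoc, hhφ, Functor.map_zero, zero_comp]
  have hkh : k ≫ h = 0 := by
    have h₀ : k⟦(-1 : ℤ)⟧' ≫ h⟦(-1 : ℤ)⟧' ≫ e.hom.app X = 0 :=
      (hφ _ ((hG i).shift (-1))).1 (by simp only [Category.assoc, zero_comp] at he ⊢; simp [he])
    apply (shiftFunctor C (-1 : ℤ)).map_injective
    rw [← cancel_mono (e.hom.app X), Functor.map_comp, Category.assoc, h₀, Functor.map_zero,
      zero_comp]
  obtain ⟨l, hl⟩ : ∃ l : G i ⟶ Y, k = l ≫ g := Triangle.coyoneda_exact₃ _ hT k hkh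
  obtain ⟨l', rfl⟩ := (hφ _ (hG i)).2 l
  rw [hl, Category.assoc, hφg, comp_zero]

end Exactness

section Duality

variable {C : Type u} [Category.{v} C] [MonoidalCategory C] [MonoidalClosed C] {κ : C}

/-- The action of `hom(-, κ)` on morphisms. -/
abbrev dualMap (κ : C) {x y : C} (f : x ⟶ y) : (ihom y).obj κ ⟶ (ihom x).obj κ :=
  (pre f).app κ

lemma dualMap_id (x : C) : dualMap κ (𝟙 x) = 𝟙 _ := by
  rw [dualMap, pre_id, NatTrans.id_app]

lemma dualMap_comp {x y z : C} (f : x ⟶ y) (g : y ⟶ z) :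
    dualMap κ (f ≫ g) = dualMap κ g ≫ dualMap κ f := by
  rw [dualMap, pre_map, NatTrans.comp_app]

/-- The isomorphism `hom(y, κ) ≅ hom(x, κ)` induced by an isomorphism `x ≅ y`. -/
@[simps]
def dualIso (κ : C) {x y : C} (e : x ≅ y) : (ihom y).obj κ ≅ (ihom x).obj κ where
  hom := dualMap κ e.hom
  inv := dualMap κ e.inv
  hom_inv_id := by rw [← dualMap_comp, e.inv_hom_id, dualMap_id]
  inv_hom_id := by rw [← dualMap_comp, e.hom_inv_id, dualMap_id]

instance {x y : C} (f : x ⟶ y) [IsIso f] : IsIso (dualMap κ f) :=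
  (dualIso κ (asIso f)).isIso_hom

variable [SymmetricCategory C]

/-- The bijection `Hom(y, hom(x, κ)) ≃ Hom(x, hom(y, κ))` exhibiting `hom(-, κ)` as self-adjoint
on the right. -/
def dualSwap {x y : C} (g : y ⟶ (ihom x).obj κ) : x ⟶ (ihom y).obj κ :=
  curry ((β_ y x).hom ≫ uncurry g)

@[simp]
lemma dualSwap_dualSwap {x y : C} (g : y ⟶ (ihom x).obj κ) : dualSwap (dualSwap g) = g := by
  simp [dualSwap]

lemma dualSwap_comp {x y z : C} (t : z ⟶ y) (g : y ⟶ (ihom x).obj κ) :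
    dualSwap (t ≫ g) = dualSwap g ≫ dualMap κ t := by
  rw [dualSwap, dualSwap, curry_pre_app, uncurry_natural_left,
    BraidedCategory.braiding_naturality_left_assoc]

lemma dualSwap_comp_dualMap {x y z : C} (g : y ⟶ (ihom x).obj κ) (t : z ⟶ x) :
    dualSwap (g ≫ dualMap κ t) = t ≫ dualSwap g := by
  rw [dualSwap, dualSwap, ← curry_natural_left, uncurry_pre_app,
    BraidedCategory.braiding_naturality_right_assoc]

lemma varpi_eq_dualSwap (κ x : C) : varpi κ x = dualSwap (𝟙 _) := by
  rw [dualSwap, uncurry_id_eq_ev, varpi]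

lemma varpi_comp_dualMap {x y : C} (g : y ⟶ (ihom x).obj κ) :
    varpi κ x ≫ dualMap κ g = dualSwap g := by
  rw [varpi_eq_dualSwap, ← dualSwap_comp, Category.comp_id]

lemma varpi_naturality (κ : C) {x y : C} (f : x ⟶ y) :
    f ≫ varpi κ y = varpi κ x ≫ dualMap κ (dualMap κ f) := by
  rw [varpi_comp_dualMap, varpi_eq_dualSwap, ← dualSwap_comp_dualMap, Category.id_comp]

lemma isIso_varpi_of_retract {x y : C} (s : x ⟶ y) (r : y ⟶ x) (hsr : s ≫ r = 𝟙 x)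
    [IsIso (varpi κ y)] : IsIso (varpi κ x) := by
  have hsr' : dualMap κ (dualMap κ s) ≫ dualMap κ (dualMap κ r) = 𝟙 _ := by
    rw [← dualMap_comp, ← dualMap_comp, hsr, dualMap_id, dualMap_id]
  refine ⟨dualMap κ (dualMap κ s) ≫ inv (varpi κ y) ≫ r, ?_, ?_⟩
  · rw [← reassoc_of% (varpi_naturality κ s), IsIso.hom_inv_id_assoc, hsr]
  · rw [Category.assoc, Category.assoc, varpi_naturality κ r, IsIso.inv_hom_id_assoc, hsr']

lemma isIso_varpi_of_iso {x y : C} (e : x ≅ y) (h : IsIso (varpi κ x)) : IsIso (varpi κ y) :=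
  isIso_varpi_of_retract e.inv e.hom e.inv_hom_id

variable [Preadditive C]

lemma isZero_ihom_obj {x : C} (hx : IsZero x) : IsZero ((ihom x).obj κ) := by
  rw [IsZero.iff_id_eq_zero, ← dualSwap_dualSwap (𝟙 _), ← dualSwap_dualSwap (0 : _ ⟶ _)]
  exact congrArg dualSwap (hx.eq_of_src _ _)

lemma isIso_varpi_of_covExact {x₁ x₂ x₃ x₄ x₅ : C}
    {f₁ : x₁ ⟶ x₂} {f₂ : x₂ ⟶ x₃} {f₃ : x₃ ⟶ x₄} {f₄ : x₄ ⟶ x₅}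
    (hf₁ : CovExact f₁ f₂) (hf₂ : CovExact f₂ f₃) (hf₃ : CovExact f₃ f₄)
    (hg₁ : CovExact (dualMap κ (dualMap κ f₁)) (dualMap κ (dualMap κ f₂)))
    (hg₂ : CovExact (dualMap κ (dualMap κ f₂)) (dualMap κ (dualMap κ f₃)))
    (hg₃ : CovExact (dualMap κ (dualMap κ f₃)) (dualMap κ (dualMap κ f₄)))
    (h₁ : IsIso (varpi κ x₁)) (h₂ : IsIso (varpi κ x₂))
    (h₄ : IsIso (varpi κ x₄)) (h₅ : IsIso (varpi κ x₅)) : IsIso (varpi κ x₃) :=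
  isIso_of_covExact hf₁ hf₂ hf₃ hg₁ hg₂ hg₃ _ _ _ _ _ (varpi_naturality κ f₁)
    (varpi_naturality κ f₂) (varpi_naturality κ f₃) (varpi_naturality κ f₄)

variable [HasZeroObject C]

lemma dualMap_zero (x y : C) : dualMap κ (0 : x ⟶ y) = 0 := by
  obtain ⟨z, hz⟩ := HasZeroObject.zero (C := C)
  have h : (0 : x ⟶ y) = (0 : x ⟶ z) ≫ (0 : z ⟶ y) := by simp
  rw [h, dualMap_comp, (isZero_ihom_obj hz).eq_of_src (dualMap κ (0 : x ⟶ z)) 0, comp_zero]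

lemma dualSwap_zero (x y : C) : dualSwap (0 : y ⟶ (ihom x).obj κ) = 0 := by
  have h : (0 : y ⟶ (ihom x).obj κ) = (0 : y ⟶ y) ≫ 0 := by simp
  rw [h, dualSwap_comp, dualMap_zero, comp_zero]

lemma ContraExact.covExact_dualMap {x y z : C} {p : x ⟶ y} {q : y ⟶ z} (h : ContraExact p q) :
    CovExact (dualMap κ q) (dualMap κ p) where
  zero := by rw [← dualMap_comp, h.zero, dualMap_zero]
  lift g hg := by
    obtain ⟨l, hl⟩ := h.desc (dualSwap g) (by rw [← dualSwap_comp_dualMap, hg, dualSwap_zero])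
    exact ⟨dualSwap l, by rw [← dualSwap_dualSwap (_ ≫ _), dualSwap_comp_dualMap, dualSwap_dualSwap,
      hl, dualSwap_dualSwap]⟩

variable [HasShift C ℤ] [∀ n : ℤ, (shiftFunctor C n).Additive] [Pretriangulated C]

lemma covExact_dualMap (κ : C) (T : Triangle C) (hT : T ∈ distTriang C) :
    CovExact (dualMap κ T.mor₂) (dualMap κ T.mor₁) :=
  (contraExact_of_distTriang T hT).covExact_dualMap

lemma covExact_dualMap_dualMap (κ : C) (T : Triangle C) (hT : T ∈ distTriang C) :
    CovExact (dualMap κ (dualMap κ T.mor₁)) (dualMap κ (dualMap κ T.mor₂)) :=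
  ((covExact_dualMap κ T hT).contraExact
    (covExact_dualMap κ _ (inv_rot_of_distTriang T hT))).covExact_dualMap

lemma isIso_varpi_obj₃ (T : Triangle C) (hT : T ∈ distTriang C)
    (h₁ : IsIso (varpi κ T.obj₁)) (h₂ : IsIso (varpi κ T.obj₂))
    (h₁' : IsIso (varpi κ (T.obj₁⟦(1 : ℤ)⟧))) (h₂' : IsIso (varpi κ (T.obj₂⟦(1 : ℤ)⟧))) :
    IsIso (varpi κ T.obj₃) := by
  have hmk {x y z : C} {f : x ⟶ y} {g : y ⟶ z} {h : z ⟶ x⟦(1 : ℤ)⟧}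
      (hf : Triangle.mk f g h ∈ distTriang C) : CovExact f g ∧
        CovExact (dualMap κ (dualMap κ f)) (dualMap κ (dualMap κ g)) :=
    ⟨covExact_of_distTriang _ hf, covExact_dualMap_dualMap κ _ hf⟩
  obtain ⟨e₁, d₁⟩ := hmk hT
  obtain ⟨e₂, d₂⟩ := hmk (rot_of_distTriang _ hT)
  obtain ⟨e₃, d₃⟩ := hmk (rot_of_distTriang _ (rot_of_distTriang _ hT))
  exact isIso_varpi_of_covExact e₁ e₂ e₃ d₁ d₂ d₃ h₁ h₂ h₁' h₂'

lemma isThickSubcategory_dual {S : Set C} (hS : IsThickSubcategory S) (κ : C) :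
    IsThickSubcategory {x : C | ∀ n : ℤ, (ihom (x⟦n⟧)).obj κ ∈ S} where
  zero x hx n := hS.zero _ (isZero_ihom_obj ((shiftFunctor C n).map_isZero hx))
  shift x hx m n := hS.mem_of_iso (dualIso κ ((shiftFunctorAdd C m n).app x).symm) (hx (m + n))
  ext₃ T hT h₁ h₂ n := by
    have hT' := Triangle.shift_distinguished T hT n
    exact hS.mem_of_covExact (covExact_dualMap κ _ (rot_of_distTriang _ hT'))
      (covExact_dualMap κ _ hT')
      (hS.mem_of_iso (dualIso κ ((shiftFunctorAdd C n 1).app T.obj₁).symm) (h₁ (n + 1)))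
      (h₂ n) (h₁ n)
  retract x y := by
    rintro ⟨s, r, hsr⟩ hy n
    refine hS.retract _ _ ⟨dualMap κ (r⟦n⟧'), dualMap κ (s⟦n⟧'), ?_⟩ (hy n)
    rw [← dualMap_comp, ← Functor.map_comp, hsr, CategoryTheory.Functor.map_id, dualMap_id]

lemma isThickSubcategory_reflexive (κ : C) :
    IsThickSubcategory {x : C | ∀ n : ℤ, IsIso (varpi κ (x⟦n⟧))} where
  zero x hx n := by
    have h := (shiftFunctor C n).map_isZero hx
    exact ⟨0, h.eq_of_src _ _, (isZero_ihom_obj (isZero_ihom_obj h)).eq_of_src _ _⟩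
  shift x hx m n := isIso_varpi_of_iso ((shiftFunctorAdd C m n).app x) (hx (m + n))
  ext₃ T hT h₁ h₂ n :=
    isIso_varpi_obj₃ _ (Triangle.shift_distinguished T hT n) (h₁ n) (h₂ n)
      (isIso_varpi_of_iso ((shiftFunctorAdd C n 1).app T.obj₁) (h₁ (n + 1)))
      (isIso_varpi_of_iso ((shiftFunctorAdd C n 1).app T.obj₂) (h₂ (n + 1)))
  retract x y := by
    rintro ⟨s, r, hsr⟩ hy n
    have := hy n
    exact isIso_varpi_of_retract (s⟦n⟧') (r⟦n⟧')
      (by rw [← Functor.map_comp, hsr, CategoryTheory.Functor.map_id])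

end Duality

section Rigid

variable {C : Type u} [Category.{v} C] [MonoidalCategory C]

/-- A rigid object is right dual to its `𝟙`-linear dual. -/
lemma IsRigid.exists_exactPairing [MonoidalClosed C] {d : C} (hd : IsRigid d) :
    Nonempty (ExactPairing ((ihom d).obj (𝟙_ C)) d) := by
  have := hd d
  have := hd (𝟙_ C)
  let e := (ihom d).obj (𝟙_ C)
  let ev : d ⊗ e ⟶ 𝟙_ C := (ihom.ev d).app (𝟙_ C)
  have huncurry (y : C) {z : C} (g : z ⟶ e ⊗ y) :
      uncurry (g ≫ rigidComparison d y) = d ◁ g ≫ (α_ d e y).inv ≫ ev ▷ y ≫ (λ_ y).hom := by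
    rw [uncurry_natural_left, rigidComparison, uncurry_curry]
  let co : 𝟙_ C ⟶ e ⊗ d := curry (ρ_ d).hom ≫ inv (rigidComparison d d)
  have hco : d ◁ co ≫ (α_ d e d).inv ≫ ev ▷ d = (ρ_ d).hom ≫ (λ_ d).inv := by
    rw [← cancel_mono (λ_ d).hom, Category.assoc, Category.assoc, ← huncurry]
    simp [co]
  refine ⟨⟨co, ev, hco, ?_⟩⟩
  rw [← cancel_mono (rigidComparison d (𝟙_ C))]
  apply uncurry_injective
  rw [huncurry, huncurry]
  calc _ = 𝟙 _ ⊗≫ d ◁ co ▷ e ⊗≫ ((d ⊗ e) ◁ ev ≫ ev ▷ (𝟙_ C)) ⊗≫ 𝟙 _ := by monoidal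
    _ = 𝟙 _ ⊗≫ (d ◁ co ≫ (α_ d e d).inv ≫ ev ▷ d) ▷ e ⊗≫ ev := by
      rw [whisker_exchange]; monoidal
    _ = _ := by rw [hco]; monoidal

open Functor.LaxMonoidal Functor.OplaxMonoidal in
/-- Monoidal functors preserve exact pairings. -/
@[reducible]
def exactPairingMap {D : Type u₂} [Category.{v} D] [MonoidalCategory D] (F : C ⥤ D) [F.Monoidal]
    (x y : C) [ExactPairing x y] : ExactPairing (F.obj x) (F.obj y) where
  coevaluation' := ε F ≫ F.map (η_ x y) ≫ δ F x y
  evaluation' := μ F y x ≫ F.map (ε_ x y) ≫ η F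
  coevaluation_evaluation' := by
    have h := (F.obj y ◁ ε F ≫ μ F y (𝟙_ C)) ≫=
      (F.congr_map (ExactPairing.coevaluation_evaluation x y) =≫ (δ F (𝟙_ C) y ≫ η F ▷ F.obj y))
    simp only [Functor.map_comp, Functor.Monoidal.map_whiskerLeft, Functor.Monoidal.map_whiskerRight,
      Functor.Monoidal.map_associator_inv, Functor.Monoidal.map_rightUnitor,
      Functor.Monoidal.map_leftUnitor_inv, Category.assoc, Functor.Monoidal.μ_δ_assoc] at h
    simp only [← MonoidalCategory.whiskerLeft_comp_assoc, ← comp_whiskerRight, Functor.Monoidal.ε_η,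
      MonoidalCategory.whiskerLeft_id, id_whiskerRight, Category.id_comp, Category.comp_id] at h
    simpa using h
  evaluation_coevaluation' := by
    have h := (ε F ▷ F.obj x ≫ μ F (𝟙_ C) x) ≫=
      (F.congr_map (ExactPairing.evaluation_coevaluation x y) =≫ (δ F x (𝟙_ C) ≫ F.obj x ◁ η F))
    simp only [Functor.map_comp, Functor.Monoidal.map_whiskerLeft, Functor.Monoidal.map_whiskerRight,
      Functor.Monoidal.map_associator, Functor.Monoidal.map_leftUnitor,
      Functor.Monoidal.map_rightUnitor_inv, Category.assoc, Functor.Monoidal.μ_δ_assoc] at h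
    simp only [← MonoidalCategory.whiskerLeft_comp_assoc, ← comp_whiskerRight_assoc,
      Functor.Monoidal.ε_η, id_whiskerRight, Category.id_comp] at h
    simpa using h

end Rigid

section ProjectionFormula

open Functor.LaxMonoidal Functor.OplaxMonoidal

variable {D : Type u₁} {C : Type u₂} [Category.{v} D] [Category.{v} C]
  [MonoidalCategory D] [MonoidalCategory C] {F : D ⥤ C} [F.Monoidal] {G : C ⥤ D} (adj : F ⊣ G)

/-- The projection formula map `f_*(c) ⊗ d ⟶ f_*(c ⊗ f^*(d))`, in which the pulled back factor is
on the right. -/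
def projFormulaRight (c : C) (d : D) : G.obj c ⊗ d ⟶ G.obj (c ⊗ F.obj d) :=
  adj.homEquiv _ _ (δ F (G.obj c) d ≫ adj.counit.app c ▷ F.obj d)

lemma tensorRightHomEquiv_comp_projFormulaRight {c : C} {e d z : D} [ExactPairing e d]
    (k : z ⊗ e ⟶ G.obj c) :
    letI := exactPairingMap F e d
    tensorRightHomEquiv z e d (G.obj c) k ≫ projFormulaRight adj c d =
      adj.homEquiv _ _ (tensorRightHomEquiv (F.obj z) (F.obj e) (F.obj d) c
        (μ F z e ≫ (adj.homEquiv _ _).symm k)) := by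
  let := exactPairingMap F e d
  have hη : η_ (F.obj e) (F.obj d) = ε F ≫ F.map (η_ e d) ≫ δ F e d := rfl
  rw [projFormulaRight, ← adj.homEquiv_naturality_left, EmbeddingLike.apply_eq_iff_eq]
  simp only [tensorRightHomEquiv, Equiv.coe_fn_mk, hη, adj.homEquiv_counit,
    Functor.Monoidal.map_whiskerLeft, Functor.Monoidal.map_whiskerRight,
    Functor.Monoidal.map_associator_inv, Functor.Monoidal.map_rightUnitor_inv, Functor.map_comp,
    MonoidalCategory.whiskerLeft_comp, comp_whiskerRight, Category.assoc,
    Functor.Monoidal.μ_δ_assoc]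

lemma isIso_projFormulaRight (c : C) (e d : D) [ExactPairing e d] :
    IsIso (projFormulaRight adj c d) := by
  let := exactPairingMap F e d
  refine isIso_of_yoneda_map_bijective _ fun z => ?_
  have h : (fun g : z ⟶ G.obj c ⊗ d => g ≫ projFormulaRight adj c d) =
      (tensorRightHomEquiv z e d (G.obj c)).symm.trans ((adj.homEquiv _ _).symm.trans
        ((Iso.homCongr (Functor.Monoidal.μIso F z e).symm (Iso.refl _)).trans
        ((tensorRightHomEquiv (F.obj z) (F.obj e) (F.obj d) c).trans (adj.homEquiv _ _)))) := by
    ext g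
    obtain ⟨k, rfl⟩ := (tensorRightHomEquiv z e d (G.obj c)).surjective g
    simp [tensorRightHomEquiv_comp_projFormulaRight]
  rw [h]
  exact Equiv.bijective _

end ProjectionFormula

section Pushforward

open Functor.LaxMonoidal Functor.OplaxMonoidal

variable {D : Type u₁} {C : Type u₂} [Category.{v} D] [Category.{v} C]
  [MonoidalCategory D] [MonoidalCategory C] {F : D ⥤ C} {G : C ⥤ D} [G.LaxMonoidal]

lemma μ_eq_homEquiv [F.OplaxMonoidal] (adj : F ⊣ G) [adj.IsMonoidal] (x y : C) :
    μ G x y = adj.homEquiv (G.obj x ⊗ G.obj y) (x ⊗ y)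
      (δ F _ _ ≫ (adj.counit.app x ⊗ₘ adj.counit.app y)) := by
  rw [Adjunction.IsMonoidal.leftAdjoint_μ (adj := adj), adj.homEquiv_unit]

lemma whiskerLeft_homEquiv_comp_μ [F.Monoidal] (adj : F ⊣ G) [adj.IsMonoidal] {c x : C} {d : D}
    (g : F.obj d ⟶ x) :
    G.obj c ◁ adj.homEquiv d x g ≫ μ G c x = projFormulaRight adj c d ≫ G.map (c ◁ g) := by
  have h : F.obj (G.obj c) ◁ F.map (adj.homEquiv d x g) ≫ (adj.counit.app c ⊗ₘ adj.counit.app x) =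
      adj.counit.app c ▷ F.obj d ≫ c ◁ g := by
    have hg : F.map (adj.homEquiv d x g) ≫ adj.counit.app x = g :=
      (adj.homEquiv_counit ..).symm.trans (Equiv.symm_apply_apply _ _)
    rw [← id_tensorHom, tensorHom_comp_tensorHom, Category.id_comp]
    exact (congrArg (adj.counit.app c ⊗ₘ ·) hg).trans (tensorHom_def _ _)
  rw [μ_eq_homEquiv adj, ← adj.homEquiv_naturality_left, projFormulaRight,
    ← adj.homEquiv_naturality_right, ← δ_natural_right_assoc, Category.assoc]
  exact congrArg _ (_ ≫= h)

lemma braiding_hom_comp_μ [BraidedCategory D] [BraidedCategory C] [F.Braided] (adj : F ⊣ G)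
    [adj.IsMonoidal] (x y : C) :
    (β_ (G.obj x) (G.obj y)).hom ≫ μ G y x = μ G x y ≫ G.map (β_ x y).hom := by
  have h : (β_ _ _).hom ≫ (adj.counit.app y ⊗ₘ adj.counit.app x) =
      (adj.counit.app x ⊗ₘ adj.counit.app y) ≫ (β_ x y).hom :=
    (BraidedCategory.braiding_naturality _ _).symm
  rw [μ_eq_homEquiv adj, μ_eq_homEquiv adj, ← adj.homEquiv_naturality_left,
    ← adj.homEquiv_naturality_right, Functor.map_braiding, Category.assoc, Category.assoc,
    Category.assoc, Functor.Monoidal.μ_δ_assoc]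
  exact congrArg _ (_ ≫= h)

variable [MonoidalClosed D] [MonoidalClosed C] {κ' : C} {κ : D} (p : G.obj κ' ⟶ κ)

/-- The comparison map `f_*(hom(c, κ')) ⟶ hom(f_*(c), κ)` induced by a map `f_*(κ') ⟶ κ`. -/
def pushforwardDual (c : C) : G.obj ((ihom c).obj κ') ⟶ (ihom (G.obj c)).obj κ :=
  curry (μ G c _ ≫ G.map ((ihom.ev c).app κ') ≫ p)

lemma uncurry_map_comp_pushforwardDual {c x : C} (g : x ⟶ (ihom c).obj κ') :
    uncurry (G.map g ≫ pushforwardDual p c) = μ G c x ≫ G.map (uncurry g) ≫ p := by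
  rw [uncurry_natural_left, pushforwardDual, uncurry_curry, μ_natural_right_assoc,
    ← Functor.map_comp_assoc, uncurry_eq]

lemma uncurry_homEquiv_comp_pushforwardDual [F.Monoidal] (adj : F ⊣ G) [adj.IsMonoidal]
    {c : C} {d : D} (g : F.obj d ⟶ (ihom c).obj κ') :
    uncurry (adj.homEquiv _ _ g ≫ pushforwardDual p c) =
      projFormulaRight adj c d ≫ G.map (uncurry g) ≫ p := by
  rw [uncurry_natural_left, pushforwardDual, uncurry_curry, ← Category.assoc,
    whiskerLeft_homEquiv_comp_μ, Category.assoc, ← Functor.map_comp_assoc, uncurry_eq]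

lemma bijective_comp_pushforwardDual [F.Monoidal] (adj : F ⊣ G) [adj.IsMonoidal]
    (hp : ∀ c : C, Function.Bijective (fun g : c ⟶ κ' => G.map g ≫ p)) (c : C) {d : D}
    (hd : IsRigid d) :
    Function.Bijective
      (fun g : d ⟶ G.obj ((ihom c).obj κ') => g ≫ pushforwardDual p c) := by
  obtain ⟨_⟩ := hd.exists_exactPairing
  have := isIso_projFormulaRight adj c ((ihom d).obj (𝟙_ D)) d
  have h : (fun g : d ⟶ G.obj ((ihom c).obj κ') => g ≫ pushforwardDual p c) =
      curry ∘ (fun k => projFormulaRight adj c d ≫ k) ∘ (fun g => G.map g ≫ p) ∘ uncurry ∘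
        (adj.homEquiv _ _).symm := by
    ext g
    obtain ⟨g, rfl⟩ := (adj.homEquiv _ _).surjective g
    apply uncurry_injective
    simp [uncurry_homEquiv_comp_pushforwardDual]
  rw [h]
  exact ((ihom.adjunction _).homEquiv _ _).bijective.comp
    (((asIso (projFormulaRight adj c d)).symm.homFromEquiv.bijective).comp ((hp _).comp
      (((ihom.adjunction _).homEquiv _ _).symm.bijective.comp (Equiv.bijective _))))

variable [SymmetricCategory D] [SymmetricCategory C]

lemma dualSwap_pushforwardDual [F.Braided] (adj : F ⊣ G) [adj.IsMonoidal] (c : C) :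
    dualSwap (pushforwardDual p c) = G.map (varpi κ' c) ≫ pushforwardDual p _ := by
  apply uncurry_injective
  rw [uncurry_map_comp_pushforwardDual, varpi, uncurry_curry, dualSwap, uncurry_curry,
    pushforwardDual, uncurry_curry, reassoc_of% (braiding_hom_comp_μ adj), Functor.map_comp_assoc]

lemma isIso_varpi_obj [F.Braided] (adj : F ⊣ G) [adj.IsMonoidal]
    (hp : ∀ c : C, IsIso (pushforwardDual p c)) {c : C} (hc : IsIso (varpi κ' c)) :
    IsIso (varpi κ (G.obj c)) := by
  have h := hp c
  have h' := hp ((ihom c).obj κ')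
  have : IsIso (varpi κ (G.obj c) ≫ dualMap κ (pushforwardDual p c)) := by
    rw [varpi_comp_dualMap, dualSwap_pushforwardDual p adj]
    infer_instance
  exact IsIso.of_isIso_comp_right _ (dualMap κ (pushforwardDual p c))

end Pushforward

/-- Theorem 6.1: abstract Matlis duality. -/
theorem statement19 {D : Type u₁} {C : Type u₂}
    [Category.{v} D] [Preadditive D] [HasZeroObject D] [HasShift D ℤ]
    [∀ n : ℤ, (shiftFunctor D n).Additive] [Pretriangulated D] [IsTriangulated D]
    [MonoidalCategory D] [SymmetricCategory D] [MonoidalClosed D]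
    [Category.{v} C] [Preadditive C] [HasZeroObject C] [HasShift C ℤ]
    [∀ n : ℤ, (shiftFunctor C n).Additive] [Pretriangulated C] [IsTriangulated C]
    [MonoidalCategory C] [SymmetricCategory C] [MonoidalClosed C]
    (fstar : D ⥤ C) [fstar.Braided] [fstar.CommShift ℤ] [fstar.IsTriangulated]
    (hD : RigidlyCompactlyGenerated D) (hC : RigidlyCompactlyGenerated C)
    (hcop : PreservesCoproducts fstar)
    (fpush : C ⥤ D) (adj1 : fstar ⊣ fpush)
    (fone : D ⥤ C) (adj2 : fpush ⊣ fone)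
    (C₀ : Set C) (hmod : IsSubmodule C₀)
    (κ' : C) (hκ' : IsExternalDualizing C₀ κ')
    (κ : D) (hlift : Nonempty (fone.obj κ ≅ κ')) :
    IsExternalDualizing (thickClosure (fpush.obj '' C₀)) κ := by
  let := adj1.rightAdjointLaxMonoidal
  let := adj1.rightAdjointCommShift ℤ
  obtain ⟨i⟩ := hlift
  obtain ⟨ι, X, hX, hX₀⟩ := hD.exists_generators
  let p : fpush.obj κ' ⟶ κ := (adj2.homEquiv _ _).symm i.inv
  have hp (c : C) : Function.Bijective (fun g : c ⟶ κ' => fpush.map g ≫ p) := by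
    have h : (fun g : c ⟶ κ' => fpush.map g ≫ p) =
        i.symm.homToEquiv.trans (adj2.homEquiv _ _).symm := by
      ext g
      exact (adj2.homEquiv_naturality_left_symm _ _).symm
    rw [h]
    exact Equiv.bijective _
  have hθ (c : C) : IsIso (pushforwardDual p c) :=
    isIso_of_bijective_of_isCompactObj hX hX₀ _ fun t ht =>
      bijective_comp_pushforwardDual p adj1 hp c ((hD.compact_iff_rigid t).1 ht)
  have hthick := isThickSubcategory_thickClosure (fpush.obj '' C₀)
  have shiftIso (c : C) (n : ℤ) : (fpush.obj c)⟦n⟧ ≅ fpush.obj (c⟦n⟧) :=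
    ((fpush.commShiftIso n).app c).symm
  constructor
  · intro x hx
    have h := hx _ (isThickSubcategory_dual hthick κ) (by
      rintro _ ⟨c, hc, rfl⟩ n
      have hcn := hmod.shift c hc n
      exact hthick.mem_of_iso (asIso (pushforwardDual p (c⟦n⟧)) ≪≫ dualIso κ (shiftIso c n))
        (subset_thickClosure _ ⟨_, hκ'.stable _ hcn, rfl⟩))
    exact hthick.mem_of_iso (dualIso κ ((shiftFunctorZero D ℤ).app x).symm) (h 0)
  · intro x hx
    have h := hx _ (isThickSubcategory_reflexive κ) (by
      rintro _ ⟨c, hc, rfl⟩ n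
      exact isIso_varpi_of_iso (shiftIso c n).symm
        (isIso_varpi_obj p adj1 hθ (hκ'.reflexive _ (hmod.shift c hc n))))
    exact isIso_varpi_of_iso ((shiftFunctorZero D ℤ).app x) (h 0)

end GN
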